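/- arXiv:2303.02645 — 2 statements merged into one kernel-verified Lean document; each statement's English description precedes it below -/
import Mathlib

section
/- (Corollary 1, joint distribution with the chosen alternative.) Fix a family of nested opportunity sets (Λ, p̃) for income y, a price vector p : C → ℝ and an alternative k ∈ C, and let W ω denote the NOS welfare measure of type ω at alternative k with price p k. Then for every w ∈ Λ: μ {ω | w ≤ W ω and k is weakly optimal for ω at (p, y)} equals P_k(min(p, p̃ w), y) if p k ≤ p̃ k w, and equals 0 otherwise, where min(p, p̃ w) is the componentwise minimum of the price vectors p and c ↦ p̃ c w. -/
open MeasureTheory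
open scoped ENNReal BigOperators

/-- `i` is weakly optimal for type `ω` at price vector `p` and income `y`:
its utility is weakly largest among all alternatives. -/
def WeakOpt {Ω : Type*} {n : ℕ} (U : Ω → Fin n → ℝ → ℝ) (ω : Ω)
    (p : Fin n → ℝ) (y : ℝ) (i : Fin n) : Prop :=
  ∀ c, U ω c (y - p c) ≤ U ω i (y - p i)

/-- Choice probability `P_i(p, y)`. -/
noncomputable def ChoiceProb {Ω : Type*} [MeasurableSpace Ω] {n : ℕ}
    (μ : Measure Ω) (U : Ω → Fin n → ℝ → ℝ) (p : Fin n → ℝ) (y : ℝ) (i : Fin n) : ℝ≥0∞ :=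
  μ {ω | WeakOpt U ω p y i}

/-- Transition probability `P_{i,j}(p, p', y)`. -/
noncomputable def TransProb {Ω : Type*} [MeasurableSpace Ω] {n : ℕ}
    (μ : Measure Ω) (U : Ω → Fin n → ℝ → ℝ) (p p' : Fin n → ℝ) (y : ℝ) (i j : Fin n) : ℝ≥0∞ :=
  μ {ω | WeakOpt U ω p y i ∧ WeakOpt U ω p' y j}

/-- Regularity condition (R1): for every type, every pair of alternatives and every
residual numeraire level, sufficiently poor levels at `c'` are worse and sufficiently
rich levels at `c'` are better. -/
def Reg1 {Ω : Type*} {n : ℕ} (U : Ω → Fin n → ℝ → ℝ) : Prop :=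
  ∀ (ω : Ω) (c c' : Fin n) (m : ℝ),
    (∃ m₀ : ℝ, ∀ m' ≤ m₀, U ω c' m' < U ω c m) ∧
    (∃ m₁ : ℝ, ∀ m', m₁ ≤ m' → U ω c m < U ω c' m')

/-- Negligible ties (R2): at any price vector and income, the set of types indifferent
between two distinct alternatives has measure zero. -/
def Reg2 {Ω : Type*} [MeasurableSpace Ω] {n : ℕ} (μ : Measure Ω)
    (U : Ω → Fin n → ℝ → ℝ) : Prop :=
  ∀ (q : Fin n → ℝ) (y : ℝ) (c c' : Fin n), c ≠ c' →
    μ {ω | U ω c (y - q c) = U ω c' (y - q c')} = 0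

/-- A family of nested opportunity sets, described by an index set `Λ ⊆ ℝ`
and virtual prices `ptilde`. -/
structure NOSFamily {n : ℕ} (Λ : Set ℝ) (ptilde : ℝ → Fin n → ℝ) : Prop where
  nonempty : Λ.Nonempty
  closed : IsClosed Λ
  cont : ∀ c : Fin n, ContinuousOn (fun l => ptilde l c) Λ
  anti : ∀ l ∈ Λ, ∀ l' ∈ Λ, l < l' →
    (∀ c, ptilde l' c ≤ ptilde l c) ∧ ∃ c, ptilde l' c < ptilde l c
  unbddAbove : ∀ (c : Fin n) (M : ℝ), ∃ l ∈ Λ, M ≤ ptilde l c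
  unbddBelow : ∃ c : Fin n, ∀ M : ℝ, ∃ l ∈ Λ, ptilde l c ≤ M

/-- The NOS welfare measure of type `ω` at alternative `k` with price `pk`. -/
noncomputable def NOSWelfare {Ω : Type*} {n : ℕ} (U : Ω → Fin n → ℝ → ℝ)
    (Λ : Set ℝ) (ptilde : ℝ → Fin n → ℝ) (y : ℝ) (k : Fin n) (pk : ℝ) (ω : Ω) : ℝ :=
  sSup {l | l ∈ Λ ∧ ∀ c, U ω c (y - ptilde l c) ≤ U ω k (y - pk)}

/-- The money-metric utility of type `ω` at alternative `k` with price `pk`,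
income `y` and reference prices `r`. -/
noncomputable def MMU {Ω : Type*} {n : ℕ} (U : Ω → Fin n → ℝ → ℝ)
    (r : Fin n → ℝ) (y : ℝ) (k : Fin n) (pk : ℝ) (ω : Ω) : ℝ :=
  sSup {l : ℝ | ∀ c, U ω c (l - r c) ≤ U ω k (y - pk)}

/-- `CV` is a compensating variation for the price change from `p` to `p'` at income `y`. -/
def IsCV {Ω : Type*} {n : ℕ} (U : Ω → Fin n → ℝ → ℝ)
    (p p' : Fin n → ℝ) (y : ℝ) (CV : Ω → ℝ) : Prop :=
  ∀ ω, (⨆ c, U ω c (y - p c)) = ⨆ c, U ω c (y - p' c - CV ω)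

/-- `EV` is an equivalent variation for the price change from `p` to `p'` at income `y`. -/
def IsEV {Ω : Type*} {n : ℕ} (U : Ω → Fin n → ℝ → ℝ)
    (p p' : Fin n → ℝ) (y : ℝ) (EV : Ω → ℝ) : Prop :=
  ∀ ω, (⨆ c, U ω c (y - p c - EV ω)) = ⨆ c, U ω c (y - p' c)

/-- Virtual prices are weakly decreasing in the index. -/
lemma NOSFamily.antitoneOn {n : ℕ} {Λ : Set ℝ} {ptilde : ℝ → Fin n → ℝ}
    (hFam : NOSFamily Λ ptilde) (c : Fin n) : AntitoneOn (fun l => ptilde l c) Λ := by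
  intro l hl l' hl' hle
  rcases hle.eq_or_lt with rfl | hlt
  · exact le_rfl
  · exact (hFam.anti l hl l' hl' hlt).1 c

/-- An index is at most the NOS welfare measure exactly when no alternative at the
corresponding virtual prices is strictly better than the reference alternative. -/
lemma le_NOSWelfare_iff {Ω : Type*} {n : ℕ} {U : Ω → Fin n → ℝ → ℝ}
    (hCont : ∀ ω c, Continuous (U ω c)) (hMono : ∀ ω c, StrictMono (U ω c)) (hR1 : Reg1 U)
    {Λ : Set ℝ} {ptilde : ℝ → Fin n → ℝ} (hFam : NOSFamily Λ ptilde)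
    (y : ℝ) (k : Fin n) (pk : ℝ) (ω : Ω) {w : ℝ} (hw : w ∈ Λ) :
    w ≤ NOSWelfare U Λ ptilde y k pk ω ↔
      ∀ c, U ω c (y - ptilde w c) ≤ U ω k (y - pk) := by
  set S : Set ℝ := {l | l ∈ Λ ∧ ∀ c, U ω c (y - ptilde l c) ≤ U ω k (y - pk)} with hS
  have hne : S.Nonempty := by
    have hex : ∀ c, ∃ l ∈ Λ, U ω c (y - ptilde l c) ≤ U ω k (y - pk) := by
      intro c
      obtain ⟨m₀, hm₀⟩ := (hR1 ω k c (y - pk)).1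
      obtain ⟨l, hl, hle⟩ := hFam.unbddAbove c (y - m₀)
      exact ⟨l, hl, (hm₀ _ (by linarith)).le⟩
    choose L hL hLU using hex
    have : Nonempty (Fin n) := ⟨k⟩
    obtain ⟨c₀, hc₀⟩ := Finite.exists_min L
    refine ⟨L c₀, hL c₀, fun c => le_trans ((hMono ω c).monotone ?_) (hLU c)⟩
    have := hFam.antitoneOn c (hL c₀) (hL c) (hc₀ c)
    simp only at this
    linarith
  have hbdd : BddAbove S := by
    obtain ⟨c, hc⟩ := hFam.unbddBelow
    obtain ⟨m₁, hm₁⟩ := (hR1 ω k c (y - pk)).2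
    obtain ⟨l₀, hl₀, hle⟩ := hc (y - m₁)
    refine ⟨l₀, fun l hl => ?_⟩
    by_contra! hlt
    have := hFam.antitoneOn c hl₀ hl.1 hlt.le
    simp only at this
    exact (hm₁ (y - ptilde l c) (by linarith)).not_ge (hl.2 c)
  have hclosed : IsClosed S := by
    have hSeq : S = ⋂ c, Λ ∩ (fun l => U ω c (y - ptilde l c)) ⁻¹' Set.Iic (U ω k (y - pk)) := by
      ext l
      simp only [hS, Set.mem_ofPred_eq, Set.mem_iInter, Set.mem_inter_iff, Set.mem_preimage,
        Set.mem_Iic]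
      exact ⟨fun h c => ⟨h.1, h.2 c⟩, fun h => ⟨(h k).1, fun c => (h c).2⟩⟩
    rw [hSeq]
    refine isClosed_iInter fun c => ContinuousOn.preimage_isClosed_of_isClosed ?_ hFam.closed
      isClosed_Iic
    exact (hCont ω c).comp_continuousOn (continuousOn_const.sub (hFam.cont c))
  constructor
  · intro h c
    have hmem : sSup S ∈ S := hclosed.csSup_mem hne hbdd
    have := hFam.antitoneOn c hw hmem.1 h
    simp only at this
    exact le_trans ((hMono ω c).monotone (by linarith)) (hmem.2 c)
  · intro h
    exact le_csSup hbdd ⟨hw, h⟩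

/-- Corollary 1, joint distribution with the chosen alternative. -/
theorem nos_welfare_joint_with_choice {Ω : Type*} [MeasurableSpace Ω] {n : ℕ} (hn : 0 < n)
    (μ : Measure Ω) [IsProbabilityMeasure μ]
    (U : Ω → Fin n → ℝ → ℝ)
    (hCont : ∀ ω c, Continuous (U ω c))
    (hMono : ∀ ω c, StrictMono (U ω c))
    (hR1 : Reg1 U)
    (Λ : Set ℝ) (ptilde : ℝ → Fin n → ℝ) (hFam : NOSFamily Λ ptilde)
    (y : ℝ) (p : Fin n → ℝ) (k : Fin n) (w : ℝ) (hw : w ∈ Λ) :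
    μ {ω | w ≤ NOSWelfare U Λ ptilde y k (p k) ω ∧ WeakOpt U ω p y k} =
      if p k ≤ ptilde w k
      then ChoiceProb μ U (fun c => min (p c) (ptilde w c)) y k
      else 0 := by
  simp only [le_NOSWelfare_iff hCont hMono hR1 hFam y k (p k) _ hw]
  split_ifs with hk
  · unfold ChoiceProb WeakOpt
    congr 1
    ext ω
    simp only [Set.mem_ofPred_eq, min_eq_left hk]
    constructor
    · rintro ⟨hvirtual, hopt⟩ c
      rcases min_choice (p c) (ptilde w c) with h | h <;> rw [h]
      exacts [hopt c, hvirtual c]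
    · intro h
      exact ⟨fun c => le_trans ((hMono ω c).monotone (sub_le_sub_left (min_le_right _ _) y)) (h c),
        fun c => le_trans ((hMono ω c).monotone (sub_le_sub_left (min_le_left _ _) y)) (h c)⟩
  · convert measure_empty (μ := μ)
    refine Set.eq_empty_of_forall_notMem fun ω h => hk ?_
    have := (hMono ω k).le_iff_le.1 (h.1 k)
    linarith
end

section
/- (Corollary 4, joint marginal distribution of the MMU in the initial optimal bundle and the compensating variation.) Let p, p' : C → ℝ be price vectors, y ∈ ℝ an income, and CV : Ω → ℝ a compensating variation. For i ∈ C let W_i ω be the money-metric utility of type ω at alternative i with price p i and reference prices p'. Then for all w, z ∈ ℝ: μ {ω | ∃ i ∈ C, i is weakly optimal for ω at (p, y) and w ≤ W_i ω and CV ω ≤ z} = Σ_{i ∈ C} (if p i ≤ p' i + min(z, y − w) then P_i(min(p, p' + min(z, y − w)), y) else 0), where min of price vectors is taken componentwise and p' + a is the vector with components p' c + a. -/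
open MeasureTheory
open scoped ENNReal BigOperators

section

variable {Ω : Type*} {n : ℕ} {U : Ω → Fin n → ℝ → ℝ} {ω : Ω} {p p' : Fin n → ℝ} {y : ℝ}

/-- The money-metric utility is at least `w` exactly when income `w` at the reference prices
does not allow the type to do better. -/
lemma le_MMU_iff (hCont : ∀ c, Continuous (U ω c)) (hMono : ∀ c, StrictMono (U ω c))
    (hR1 : Reg1 U) (r : Fin n → ℝ) (i : Fin n) (q w : ℝ) :
    w ≤ MMU U r y i q ω ↔ ∀ c, U ω c (w - r c) ≤ U ω i (y - q) := by
  set S : Set ℝ := {l | ∀ c, U ω c (l - r c) ≤ U ω i (y - q)} with hS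
  have hbdd : BddAbove S := by
    refine ⟨y - q + r i, fun l hl => ?_⟩
    linarith [(hMono i).le_iff_le.1 (hl i)]
  have hne : S.Nonempty := by
    choose m hm using fun c => (hR1 ω i c (y - q)).1
    obtain ⟨l, hl⟩ := (Set.finite_range fun c => m c + r c).bddBelow
    refine ⟨l, fun c => (hm c _ ?_).le⟩
    linarith [hl (Set.mem_range_self c)]
  have hclosed : IsClosed S := by
    simp only [hS, Set.ofPred_forall]
    exact isClosed_iInter fun c =>
      isClosed_le ((hCont c).comp (continuous_id.sub continuous_const)) continuous_const
  refine ⟨fun h c => ?_, fun h => le_csSup hbdd h⟩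
  exact ((hMono c).monotone (sub_le_sub_right h (r c))).trans (hclosed.csSup_mem hne hbdd c)

/-- The compensating variation is at most `z` exactly when income `y - z` at the new prices
does not allow the type to do better than its initial optimum. -/
lemma IsCV.le_iff {CV : Ω → ℝ} (hCV : IsCV U p p' y CV) (hMono : ∀ c, StrictMono (U ω c))
    {i : Fin n} (hi : WeakOpt U ω p y i) (z : ℝ) :
    CV ω ≤ z ↔ ∀ c, U ω c (y - p' c - z) ≤ U ω i (y - p i) := by
  have : Nonempty (Fin n) := ⟨i⟩
  have hmax : (⨆ c, U ω c (y - p' c - CV ω)) = U ω i (y - p i) :=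
    (hCV ω).symm.trans <|
      le_antisymm (ciSup_le hi) (le_ciSup (Set.finite_range fun c => U ω c (y - p c)).bddAbove i)
  refine ⟨fun h c => ?_, fun h => ?_⟩
  · rw [← hmax]
    exact ((hMono c).monotone (by linarith)).trans
      (le_ciSup (Set.finite_range fun c => U ω c (y - p' c - CV ω)).bddAbove c)
  · by_contra! hlt
    obtain ⟨c, hc⟩ := exists_eq_ciSup_of_finite (f := fun c => U ω c (y - p' c - CV ω))
    have hstrict : U ω c (y - p' c - CV ω) < U ω c (y - p' c - z) := hMono c (by linarith)
    linarith [h c]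

/-- Weak optimality at the componentwise minimum of two price vectors, for an alternative whose
price is smallest under the first one. -/
lemma weakOpt_min_iff (hMono : ∀ c, StrictMono (U ω c)) {q : Fin n → ℝ} {i : Fin n}
    (h : p i ≤ q i) :
    WeakOpt U ω (fun c => min (p c) (q c)) y i ↔
      WeakOpt U ω p y i ∧ ∀ c, U ω c (y - q c) ≤ U ω i (y - p i) := by
  simp only [WeakOpt, min_eq_left h, ← max_sub_sub_left, (hMono _).monotone.map_max, max_le_iff,
    forall_and]

/-- The joint event for the money-metric utility and the compensating variation, in terms of
weak optimality at the componentwise minimum prices. -/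
lemma weakOpt_and_le_MMU_and_CV_le_iff {CV : Ω → ℝ} (hCont : ∀ c, Continuous (U ω c))
    (hMono : ∀ c, StrictMono (U ω c)) (hR1 : Reg1 U) (hCV : IsCV U p p' y CV)
    (i : Fin n) (w z : ℝ) :
    (WeakOpt U ω p y i ∧ w ≤ MMU U p' y i (p i) ω ∧ CV ω ≤ z) ↔
      p i ≤ p' i + min z (y - w) ∧
        WeakOpt U ω (fun c => min (p c) (p' c + min z (y - w))) y i := by
  have key : ∀ c, U ω c (y - (p' c + min z (y - w))) =
      max (U ω c (w - p' c)) (U ω c (y - p' c - z)) := by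
    intro c
    rw [← (hMono c).monotone.map_max]
    congr 1
    rcases le_total z (y - w) with h | h
    · rw [min_eq_left h, max_eq_right (by linarith)]; ring
    · rw [min_eq_right h, max_eq_left (by linarith)]; ring
  have hjoint : (WeakOpt U ω p y i ∧ w ≤ MMU U p' y i (p i) ω ∧ CV ω ≤ z) ↔
      WeakOpt U ω p y i ∧
        ∀ c, U ω c (y - (p' c + min z (y - w))) ≤ U ω i (y - p i) := by
    refine and_congr_right fun hi => ?_
    rw [le_MMU_iff hCont hMono hR1, hCV.le_iff hMono hi]
    simp only [key, max_le_iff, forall_and]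
  rw [hjoint]
  constructor
  · intro h
    have hle : p i ≤ p' i + min z (y - w) := by
      linarith [(hMono i).le_iff_le.1 (h.2 i)]
    exact ⟨hle, (weakOpt_min_iff hMono hle).2 h⟩
  · rintro ⟨hle, h⟩
    exact (weakOpt_min_iff hMono hle).1 h

end

/-- Corollary 4: joint marginal distribution of the MMU in the initial
optimal bundle and the compensating variation. -/
theorem mmu_cv_marginal_distribution {Ω : Type*} [MeasurableSpace Ω] {n : ℕ} (hn : 0 < n)
    (μ : Measure Ω) [IsProbabilityMeasure μ]
    (U : Ω → Fin n → ℝ → ℝ)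
    (hCont : ∀ ω c, Continuous (U ω c))
    (hMono : ∀ ω c, StrictMono (U ω c))
    (hR1 : Reg1 U)
    (hR2 : Reg2 μ U)
    (p p' : Fin n → ℝ) (y : ℝ) (CV : Ω → ℝ) (hCV : IsCV U p p' y CV)
    (w z : ℝ)
    (hMeas : ∀ i : Fin n,
      MeasurableSet {ω | WeakOpt U ω p y i ∧ w ≤ MMU U p' y i (p i) ω ∧ CV ω ≤ z}) :
    μ {ω | ∃ i : Fin n, WeakOpt U ω p y i ∧ w ≤ MMU U p' y i (p i) ω ∧ CV ω ≤ z} =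
      ∑ i : Fin n,
        (if p i ≤ p' i + min z (y - w)
         then ChoiceProb μ U (fun c => min (p c) (p' c + min z (y - w))) y i
         else 0) := by
  have hset : {ω | ∃ i : Fin n, WeakOpt U ω p y i ∧ w ≤ MMU U p' y i (p i) ω ∧ CV ω ≤ z} =
      ⋃ i, {ω | WeakOpt U ω p y i ∧ w ≤ MMU U p' y i (p i) ω ∧ CV ω ≤ z} :=
    Set.ofPred_exists _
  have hdisj : Pairwise (Function.onFun (AEDisjoint μ)
      fun i => {ω | WeakOpt U ω p y i ∧ w ≤ MMU U p' y i (p i) ω ∧ CV ω ≤ z}) := by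
    intro i j hij
    refine measure_mono_null ?_ (hR2 p y i j hij)
    rintro ω ⟨hi, hj⟩
    exact le_antisymm (hj.1 i) (hi.1 j)
  rw [hset, measure_iUnion₀ hdisj fun i => (hMeas i).nullMeasurableSet, tsum_fintype]
  refine Finset.sum_congr rfl fun i _ => ?_
  simp only [weakOpt_and_le_MMU_and_CV_le_iff (hCont _) (hMono _) hR1 hCV]
  split_ifs with h <;> simp [h, ChoiceProb]
end
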